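/- Let K ⊂ ℝ^N be a Lebesgue-measurable set with 0 < |K| < ∞, let S > 0, t_o ∈ ℝ, and let Q := K × (t_o − S, t_o) ⊂ ℝ^{N+1}. Let A ⊂ Q be Lebesgue-measurable and α ∈ (0,1). If |A| > α|Q| (with respect to (N+1)-dimensional Lebesgue measure), then there exists t_* ∈ [t_o − S, t_o − (α/2)S] such that the time slice satisfies |{x ∈ K : (x,t_*) ∈ A}| > (α/2)|K| (with respect to N-dimensional Lebesgue measure). -/

import Mathlib

open MeasureTheory Set

/-- **Slicing lemma.** If a measurable subset `A` of the space-time cylinder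
`Q = K × (t₀ - S, t₀)` occupies more than an `α`-fraction of `Q`, then some time slice
at a time `t⋆ ∈ [t₀ - S, t₀ - (α/2)S]` occupies more than an `(α/2)`-fraction of `K`. -/
theorem slicing_lemma (N : ℕ)
    (K : Set (EuclideanSpace ℝ (Fin N))) (hKmeas : MeasurableSet K)
    (hKpos : 0 < volume K) (hKfin : volume K < ⊤)
    (S t₀ : ℝ) (hS : 0 < S)
    (A : Set (EuclideanSpace ℝ (Fin N) × ℝ)) (hAmeas : MeasurableSet A)
    (hAQ : A ⊆ K ×ˢ Ioo (t₀ - S) t₀)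
    (α : ℝ) (hα : α ∈ Ioo (0:ℝ) 1)
    (hbig : ENNReal.ofReal α * volume (K ×ˢ Ioo (t₀ - S) t₀) < volume A) :
    ∃ tstar ∈ Icc (t₀ - S) (t₀ - (α / 2) * S),
      ENNReal.ofReal (α / 2) * volume K < volume {x ∈ K | (x, tstar) ∈ A} := by
  obtain ⟨hα0, -⟩ := hα
  by_contra! h
  refine hbig.not_ge ?_
  have hslice (t : ℝ) : {x ∈ K | (x, t) ∈ A} = (fun x => (x, t)) ⁻¹' A := by
    ext x
    exact ⟨fun hx => hx.2, fun hx => ⟨(hAQ hx).1, hx⟩⟩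
  have hbound (t : ℝ) : volume ((fun x => (x, t)) ⁻¹' A) ≤
      (Icc (t₀ - S) (t₀ - (α / 2) * S)).indicator
          (fun _ => ENNReal.ofReal (α / 2) * volume K) t +
        (Ioo (t₀ - (α / 2) * S) t₀).indicator (fun _ => volume K) t := by
    by_cases ht : t ∈ Icc (t₀ - S) (t₀ - (α / 2) * S)
    · rw [indicator_of_mem ht, ← hslice]
      exact le_add_right (h t ht)
    by_cases ht' : t ∈ Ioo (t₀ - (α / 2) * S) t₀
    · rw [indicator_of_mem ht']
      exact le_add_left (measure_mono fun x hx => (hAQ hx).1)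
    · have hempty : (fun x => (x, t)) ⁻¹' A = ∅ := by
        refine eq_empty_of_forall_notMem fun x hx => ?_
        obtain ⟨h₁, h₂⟩ : t ∈ Ioo (t₀ - S) t₀ := (hAQ hx).2
        rcases le_or_gt t (t₀ - (α / 2) * S) with h₃ | h₃
        · exact ht ⟨h₁.le, h₃⟩
        · exact ht' ⟨h₃, h₂⟩
      simp [hempty]
  calc volume A
      = ∫⁻ t, volume ((fun x => (x, t)) ⁻¹' A) := by
        rw [Measure.volume_eq_prod, Measure.prod_apply_symm hAmeas]
    _ ≤ ENNReal.ofReal (α / 2) * volume K * ENNReal.ofReal (t₀ - (α / 2) * S - (t₀ - S)) +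
          volume K * ENNReal.ofReal (t₀ - (t₀ - (α / 2) * S)) := by
        refine (lintegral_mono hbound).trans_eq ?_
        rw [lintegral_add_left (measurable_const.indicator measurableSet_Icc),
          lintegral_indicator_const measurableSet_Icc,
          lintegral_indicator_const measurableSet_Ioo, Real.volume_Icc, Real.volume_Ioo]
    _ ≤ ENNReal.ofReal (α / 2) * volume K * ENNReal.ofReal S +
          volume K * (ENNReal.ofReal (α / 2) * ENNReal.ofReal S) := by
        rw [sub_sub_cancel, ENNReal.ofReal_mul (by positivity)]
        gcongr
        nlinarith [mul_pos hα0 hS]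
    _ = (ENNReal.ofReal (α / 2) + ENNReal.ofReal (α / 2)) *
          (volume K * ENNReal.ofReal S) := by ring
    _ = ENNReal.ofReal α * volume (K ×ˢ Ioo (t₀ - S) t₀) := by
        rw [← ENNReal.ofReal_add (by positivity) (by positivity), add_halves,
          Measure.volume_eq_prod, Measure.prod_prod, Real.volume_Ioo, sub_sub_cancel]
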